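/- Let G be a finite group which has an ES-partition for a subgroup S that is solvable. Then G is solvable. -/

import Mathlib

/-- A strict `S`-partition of a group `G`: a finite collection of at least two proper
subgroups of `G` covering `G`, any two distinct members of which intersect exactly in `S`. -/
def IsStrictPartition {G : Type*} [Group G] (S : Subgroup G) (P : Finset (Subgroup G)) : Prop :=
  2 ≤ P.card ∧ (∀ H ∈ P, H ≠ ⊤) ∧ (∀ g : G, ∃ H ∈ P, g ∈ H) ∧
    ∀ H ∈ P, ∀ K ∈ P, H ≠ K → H ⊓ K = S

/-- An `ES`-partition: a strict `S`-partition all of whose components have the same order. -/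
def IsESPartition {G : Type*} [Group G] (S : Subgroup G) (P : Finset (Subgroup G)) : Prop :=
  IsStrictPartition S P ∧ ∀ H ∈ P, ∀ K ∈ P, Nat.card H = Nat.card K

theorem MulAction.dvd_sum_of_dvd_card_orbit_mul {A X : Type*} [Group A] [MulAction A X] [Fintype X]
    (F : X → ℕ) (hF : ∀ (a : A) (x : X), F (a • x) = F x) (d : ℕ)
    (hd : ∀ x, d ∣ Nat.card (MulAction.orbit A x) * F x) : d ∣ ∑ x, F x := by
  classical
  have : Fintype (Quotient (MulAction.orbitRel A X)) := Fintype.ofFinite _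
  have h : ∀ q : Quotient (MulAction.orbitRel A X), Fintype (MulAction.orbit A q.out) :=
    fun q ↦ Fintype.ofFinite _
  rw [← (MulAction.selfEquivSigmaOrbits A X).symm.sum_comp, Fintype.sum_sigma]
  refine Finset.dvd_sum fun q _ ↦ ?_
  have hc : ∀ y : MulAction.orbit A q.out,
      F ((MulAction.selfEquivSigmaOrbits A X).symm ⟨q, y⟩) = F q.out := by
    rintro ⟨_, a, rfl⟩
    exact hF a _
  rw [Finset.sum_congr rfl fun y _ ↦ hc y, Finset.sum_const, Finset.card_univ, smul_eq_mul,
    ← Nat.card_eq_fintype_card]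
  exact hd _

theorem Subgroup.dvd_sum_of_conj_invariant {G : Type*} [Group G] [Fintype G] (H : Subgroup G)
    (F : G → ℕ) (hF : ∀ h ∈ H, ∀ y, F (h * y * h⁻¹) = F y) (d : ℕ)
    (hd : ∀ y, d * Nat.card (H ⊓ Subgroup.centralizer {y} : Subgroup G) ∣ Nat.card H * F y) :
    d ∣ ∑ y, F y := by
  let A : Subgroup (ConjAct G) := H.map ConjAct.toConjAct.toMonoidHom
  refine MulAction.dvd_sum_of_dvd_card_orbit_mul (A := A) F ?_ d fun y ↦ ?_
  · rintro ⟨_, h, hh, rfl⟩ y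
    exact hF h hh y
  · have hA : Nat.card A = Nat.card H :=
      Subgroup.card_map_of_injective ConjAct.toConjAct.injective
    have hs : Nat.card (MulAction.stabilizer A y) =
        Nat.card (H ⊓ Subgroup.centralizer {y} : Subgroup G) := by
      refine Nat.card_congr ⟨fun a ↦ ⟨ConjAct.ofConjAct a.1.1, ?_, ?_⟩,
        fun a ↦ ⟨⟨ConjAct.toConjAct a.1, a.1, a.2.1, rfl⟩, ?_⟩, fun _ ↦ rfl, fun _ ↦ rfl⟩
      · obtain ⟨⟨_, h, hh, rfl⟩, _⟩ := a
        exact hh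
      · have h1 : ConjAct.ofConjAct a.1.1 * y * (ConjAct.ofConjAct a.1.1)⁻¹ = y := a.2
        exact Subgroup.mem_centralizer_singleton_iff.2 (mul_inv_eq_iff_eq_mul.1 h1)
      · have h1 := Subgroup.mem_centralizer_singleton_iff.1 a.2.2
        exact mul_inv_eq_iff_eq_mul.2 h1
    have ho : Nat.card (MulAction.orbit A y) * Nat.card (MulAction.stabilizer A y) = Nat.card A := by
      rw [← Nat.card_prod]
      exact Nat.card_congr (MulAction.orbitProdStabilizerEquivGroup A y)
    have h := hd y
    rw [← hA, ← hs, ← ho, mul_right_comm] at h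
    exact Nat.dvd_of_mul_dvd_mul_right Nat.card_pos h

theorem coprime_card_of_forall_pow_eq_one {G : Type*} [Group G] [Finite G] {a b : ℕ}
    (hab : a.Coprime b) (h : ∀ x : G, x ^ b = 1) : a.Coprime (Nat.card G) := by
  refine Nat.coprime_of_dvd fun p hp hpa hpG ↦ ?_
  have := Fact.mk hp
  obtain ⟨x, hx⟩ := exists_prime_orderOf_dvd_card' p hpG
  exact Nat.not_coprime_of_dvd_of_dvd hp.one_lt hpa (hx ▸ orderOf_dvd_of_pow_eq_one (h x)) hab

/-- A case of Frobenius' theorem on the number of solutions of `x ^ a = 1`. -/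
theorem dvd_card_pow_eq_one_of_coprime {G : Type*} [Group G] [Finite G] {a b : ℕ}
    (hab : a.Coprime b) (hG : Nat.card G = a * b) : a ∣ Nat.card {x : G // x ^ a = 1} := by
  classical
  induction hn : Nat.card G using Nat.strong_induction_on generalizing G a b with
  | _ n ih =>
  have : Fintype G := Fintype.ofFinite G
  let f : G → ℕ := fun y ↦ Nat.card {x : G // x * y = y * x ∧ x ^ a = 1}
  have hsum : Nat.card G = ∑ y : G, if y ^ b = 1 then f y else 0 := by
    obtain ⟨r, hra, hrb⟩ := Nat.chineseRemainder hab 1 0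
    obtain ⟨s, hsa, hsb⟩ := Nat.chineseRemainder hab 0 1
    have hpow : ∀ x y : G, x * y = y * x → x ^ a = 1 → y ^ b = 1 →
        (x * y) ^ r = x ∧ (x * y) ^ s = y := fun x y hxy hx hy ↦ by
      rw [Commute.mul_pow hxy, Commute.mul_pow hxy, pow_eq_pow_of_modEq hra hx,
        pow_eq_pow_of_modEq hrb hy, pow_eq_pow_of_modEq hsa hx, pow_eq_pow_of_modEq hsb hy]
      simp
    have hG1 : ∀ g : G, g ^ (a * b) = 1 := fun g ↦ hG ▸ pow_card_eq_one'
    let e : G ≃ Σ y : {y : G // y ^ b = 1}, {x : G // x * y = y * x ∧ x ^ a = 1} :=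
      { toFun := fun g ↦ ⟨⟨g ^ s, by
            obtain ⟨c, rfl⟩ := (Nat.modEq_zero_iff_dvd.1 hsa)
            rw [← pow_mul, mul_right_comm, pow_mul, hG1, one_pow]⟩,
          ⟨g ^ r, (Commute.refl g).pow_pow r s, by
            obtain ⟨c, rfl⟩ := (Nat.modEq_zero_iff_dvd.1 hrb)
            rw [← pow_mul, mul_right_comm, mul_comm b, pow_mul, hG1, one_pow]⟩⟩
        invFun := fun p ↦ p.2.1 * p.1.1
        left_inv := fun g ↦ by
          have h : r + s ≡ 1 [MOD a * b] :=
            (Nat.modEq_and_modEq_iff_modEq_mul hab).1 ⟨hra.add hsa, hrb.add hsb⟩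
          simp only [← pow_add]
          rw [pow_eq_pow_of_modEq h (hG1 g), pow_one]
        right_inv := by
          rintro ⟨⟨y, hy⟩, ⟨x, hxy, hx⟩⟩
          obtain ⟨h1, h2⟩ := hpow x y hxy hx hy
          refine Sigma.ext (Subtype.ext h2) ?_
          rw [Subtype.heq_iff_coe_eq]
          · exact h1
          · simp [h2] }
    rw [Nat.card_congr e, Nat.card_sigma, ← Finset.sum_filter,
      Finset.sum_subtype (p := fun y : G ↦ y ^ b = 1) _ (by simp)]
  have hnc : a ∣ ∑ y : G, if y ^ b = 1 ∧ y ∉ Subgroup.center G then f y else 0 := by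
    refine (⊤ : Subgroup G).dvd_sum_of_conj_invariant _ (fun h _ y ↦ ?_) a fun y ↦ ?_
    · have h1 : (h * y * h⁻¹) ^ b = 1 ↔ y ^ b = 1 := by
        rw [conj_pow, conj_eq_one_iff]
      have h2 : h * y * h⁻¹ ∈ Subgroup.center G ↔ y ∈ Subgroup.center G :=
        ((Subgroup.center G).normal_of_characteristic.mem_comm_iff).trans (by simp)
      have h3 : f (h * y * h⁻¹) = f y := by
        refine (Nat.card_congr ((MulAut.conj h).toEquiv.subtypeEquiv fun x ↦ ?_)).symm
        refine and_congr ?_ ?_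
        · change x * y = y * x ↔
            MulAut.conj h x * MulAut.conj h y = MulAut.conj h y * MulAut.conj h x
          rw [← map_mul, ← map_mul, (MulAut.conj h).injective.eq_iff]
        · simp [conj_pow]
      simp only [h1, h2, h3]
    · split_ifs with hy
      · let C := Subgroup.centralizer {y}
        have hfC : f y = Nat.card {x : C // x ^ (Nat.card C).gcd a = 1} := by
          refine Nat.card_congr ((Equiv.subtypeSubtypeEquivSubtypeInter _ _).symm.trans
            ((Equiv.subtypeEquivRight fun x ↦
              Subgroup.mem_centralizer_singleton_iff.symm).subtypeEquiv fun x ↦ ?_))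
          rw [← orderOf_dvd_iff_pow_eq_one (n := (Nat.card C).gcd a), Nat.dvd_gcd_iff,
            and_iff_right (orderOf_dvd_natCard _), orderOf_dvd_iff_pow_eq_one, ← Subtype.val_inj]
          rfl
        have hCG : Nat.card C ∣ a * b := hG ▸ Subgroup.card_subgroup_dvd_card C
        have hC : Nat.card C = (Nat.card C).gcd a * (Nat.card C).gcd b := by
          rw [← hab.gcd_mul, Nat.gcd_eq_left hCG]
        have hlt : Nat.card C < n := by
          rw [← hn]
          refine lt_of_le_of_ne (Subgroup.card_le_card_group C) fun h ↦ hy.2 ?_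
          have := Subgroup.centralizer_eq_top_iff_subset.1 (Subgroup.eq_top_of_card_eq C h)
          simpa using this
        have hdvd := ih _ hlt ((hab.coprime_dvd_left (Nat.gcd_dvd_right _ _)).coprime_dvd_right
          (Nat.gcd_dvd_right _ _)) hC rfl
        rw [top_inf_eq, Subgroup.card_top, hG, mul_assoc]
        refine mul_dvd_mul_left a ?_
        change Nat.card C ∣ _
        rw [hC, mul_comm, hfC]
        exact mul_dvd_mul (Nat.gcd_dvd_right _ _) hdvd
      · simp
  have hc : (∑ y : G, if y ^ b = 1 ∧ y ∈ Subgroup.center G then f y else 0) =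
      Nat.card {y : Subgroup.center G // y ^ b = 1} * Nat.card {x : G // x ^ a = 1} := by
    have h1 : ∀ y : G, (if y ^ b = 1 ∧ y ∈ Subgroup.center G then f y else 0) =
        if y ^ b = 1 ∧ y ∈ Subgroup.center G then Nat.card {x : G // x ^ a = 1} else 0 := by
      intro y
      split_ifs with hy
      · refine Nat.card_congr (Equiv.subtypeEquivRight fun x ↦ and_iff_right ?_)
        exact Subgroup.mem_center_iff.1 hy.2 x
      · rfl
    have h2 : Nat.card {y : Subgroup.center G // y ^ b = 1} =
        Nat.card {y : G // y ^ b = 1 ∧ y ∈ Subgroup.center G} := by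
      refine Nat.card_congr (Equiv.trans ?_ ((Equiv.subtypeSubtypeEquivSubtypeInter _ _).trans
        (Equiv.subtypeEquivRight fun x ↦ and_comm)))
      exact Equiv.subtypeEquivRight fun x ↦ by simp [← Subtype.val_inj]
    rw [Finset.sum_congr rfl fun y _ ↦ h1 y, ← Finset.sum_filter, Finset.sum_const, smul_eq_mul, h2,
      Nat.card_eq_fintype_card (α := {y : G // y ^ b = 1 ∧ y ∈ Subgroup.center G}),
      Fintype.card_subtype]
  have hcop : a.Coprime (Nat.card {y : Subgroup.center G // y ^ b = 1}) := by
    let : CommGroup (Subgroup.center G) := IsMulCommutative.instCommGroup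
    exact coprime_card_of_forall_pow_eq_one
      (G := (powMonoidHom (α := Subgroup.center G) b).ker) hab fun x ↦ Subtype.ext x.2
  refine hcop.dvd_of_dvd_mul_left ?_
  rw [← hc, ← Nat.dvd_add_left hnc, ← Finset.sum_add_distrib]
  have : ∀ y : G, ((if y ^ b = 1 ∧ y ∈ Subgroup.center G then f y else 0) +
      if y ^ b = 1 ∧ y ∉ Subgroup.center G then f y else 0) = if y ^ b = 1 then f y else 0 := by
    intro y
    split_ifs <;> simp_all
  rw [Finset.sum_congr rfl fun y _ ↦ this y, ← hsum, hG]
  exact dvd_mul_right a b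

theorem IsStrictPartition.pow_eq_one_iff {G : Type*} [Group G] {P : Finset (Subgroup G)}
    (hP : IsStrictPartition ⊥ P) {H : Subgroup G} (hH : H ∈ P) {x y : G} (hx : x ∈ H)
    (hx1 : x ≠ 1) (hy : y ∉ H) (hxy : Commute x y) (n : ℕ) : x ^ n = 1 ↔ y ^ n = 1 := by
  obtain ⟨-, -, hcov, hinf⟩ := hP
  obtain ⟨K, hK, hyK⟩ := hcov y
  obtain ⟨L, hL, hxyL⟩ := hcov (x * y)
  have hbot : ∀ {A B : Subgroup G} {z : G}, A ∈ P → B ∈ P → A ≠ B → z ∈ A → z ∈ B → z = 1 :=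
    fun {A B z} hA hB hAB hzA hzB ↦ Subgroup.mem_bot.1 (hinf A hA B hB hAB ▸ ⟨hzA, hzB⟩)
  have hLH : L ≠ H := fun h ↦ hy ((H.mul_mem_cancel_left hx).1 (h ▸ hxyL))
  have hKH : K ≠ H := fun h ↦ hy (h ▸ hyK)
  have hLK : L ≠ K := fun h ↦
    hx1 (hbot hK hH hKH ((K.mul_mem_cancel_right hyK).1 (h ▸ hxyL)) hx)
  have hpow := L.pow_mem hxyL n
  rw [hxy.mul_pow] at hpow
  constructor
  · intro h
    rw [h, one_mul] at hpow
    exact hbot hL hK hLK hpow (K.pow_mem hyK n)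
  · intro h
    rw [h, mul_one] at hpow
    exact hbot hL hH hLH hpow (H.pow_mem hx n)

open Finset in
theorem IsStrictPartition.card_filter_eq_sum {G : Type*} [Group G] [Fintype G]
    {P : Finset (Subgroup G)} (hP : IsStrictPartition ⊥ P) (p : G → Prop) [DecidablePred p]
    [∀ H : Subgroup G, DecidablePred (· ∈ H)] (hp : ¬ p 1) :
    #{y | p y} = ∑ H ∈ P, #{y | p y ∧ y ∈ H} := by
  classical
  rw [← card_biUnion]
  · congr 1
    ext y
    obtain ⟨H, hH, hy⟩ := hP.2.2.1 y
    simp only [mem_filter, mem_univ, true_and, mem_biUnion]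
    exact ⟨fun h ↦ ⟨H, hH, h, hy⟩, fun ⟨_, _, h, _⟩ ↦ h⟩
  · intro H hH K hK hHK
    refine disjoint_left.2 fun y hyH hyK ↦ hp ?_
    simp only [mem_filter, mem_univ, true_and] at hyH hyK
    have : y ∈ H ⊓ K := ⟨hyH.2, hyK.2⟩
    rw [hP.2.2.2 H hH K hK hHK, Subgroup.mem_bot] at this
    exact this ▸ hyH.1

open Finset in
theorem IsESPartition.card_eq_one_add {G : Type*} [Group G] [Finite G] {P : Finset (Subgroup G)}
    (hP : IsESPartition ⊥ P) {H : Subgroup G} (hH : H ∈ P) :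
    Nat.card G = 1 + P.card * (Nat.card H - 1) := by
  classical
  have : Fintype G := Fintype.ofFinite G
  have h1 : ∀ K ∈ P, #{y | y ≠ 1 ∧ y ∈ K} = Nat.card H - 1 := fun K hK ↦ by
    rw [hP.2 H hH K hK, Nat.card_eq_fintype_card, Fintype.card_subtype,
      ← card_erase_of_mem (a := 1) (by simp)]
    congr 1
    ext y
    simp
  have h2 := hP.1.card_filter_eq_sum (· ≠ 1) (by simp)
  rw [sum_congr rfl h1, sum_const, smul_eq_mul] at h2
  rw [← h2, Nat.card_eq_fintype_card, filter_ne', card_erase_of_mem (mem_univ _), card_univ]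
  have := Fintype.card_pos (α := G)
  lia

open Finset in
/-- Conjugation by a component `H` shows that the number of elements outside `H` violating
`x ^ a = 1` is a multiple of the order of `H`. -/
theorem IsStrictPartition.card_dvd_card_pow_ne_one {G : Type*} [Group G] [Fintype G]
    {P : Finset (Subgroup G)} (hP : IsStrictPartition ⊥ P) {H : Subgroup G} (hH : H ∈ P)
    [DecidableEq G] [DecidablePred (· ∈ H)] {a b : ℕ} (hab : a.Coprime b)
    (hG : Nat.card G = a * b) : Nat.card H ∣ #{y | y ^ a ≠ 1 ∧ y ∉ H} := by
  have hkG : Nat.card H ∣ a * b := hG ▸ H.card_subgroup_dvd_card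
  have hk : Nat.card H = (Nat.card H).gcd a * (Nat.card H).gcd b := by
    rw [← hab.gcd_mul, Nat.gcd_eq_left hkG]
  have hpow : ∀ x : G, (x ^ b) ^ a = 1 := fun x ↦ by
    rw [← pow_mul, mul_comm, ← hG, pow_card_eq_one']
  have key : ∀ (c d : ℕ) (p : G → Prop) [DecidablePred p], c.Coprime d →
      (∀ h y, p (h * y * h⁻¹) ↔ p y) →
      (∀ x y, x ∈ H → y ∉ H → Commute x y → p y → x ^ d = 1) →
      (Nat.card H).gcd c ∣ #{y | p y ∧ y ∉ H} := by
    intro c d p _ hcd hconj hp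
    rw [card_filter]
    refine H.dvd_sum_of_conj_invariant _ (fun h hh y ↦ ?_) _ fun y ↦ ?_
    · have : h * y * h⁻¹ ∈ H ↔ y ∈ H := by
        rw [H.mul_mem_cancel_right (H.inv_mem hh), H.mul_mem_cancel_left hh]
      simp only [hconj, this]
    · split_ifs with hy
      · rw [mul_one]
        refine Nat.Coprime.mul_dvd_of_dvd_of_dvd ?_ (Nat.gcd_dvd_left _ _)
          (Subgroup.card_dvd_of_le inf_le_left)
        refine Nat.Coprime.coprime_dvd_left (Nat.gcd_dvd_right _ _)
          (coprime_card_of_forall_pow_eq_one hcd fun x ↦ Subtype.ext ?_)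
        exact hp x y x.2.1 hy.2 (Subgroup.mem_centralizer_singleton_iff.1 x.2.2) hy.1
      · simp
  have hA : (Nat.card H).gcd b ∣ #{y | y ^ a = 1 ∧ y ∉ H} := by
    refine key b a (fun y ↦ y ^ a = 1) hab.symm (fun h y ↦ by rw [conj_pow, conj_eq_one_iff]) ?_
    intro x y hx hy hxy h
    by_cases hx1 : x = 1
    · simp [hx1]
    · exact (hP.pow_eq_one_iff hH hx hx1 hy hxy a).2 h
  have hB : (Nat.card H).gcd a ∣ #{y | y ^ a ≠ 1 ∧ y ∉ H} := by
    refine key a b (fun y ↦ y ^ a ≠ 1) hab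
      (fun h y ↦ by rw [ne_eq, conj_pow, conj_eq_one_iff]) ?_
    intro x y hx hy hxy h
    by_contra hxb
    exact h ((hP.pow_eq_one_iff hH (H.pow_mem hx b) hxb hy (hxy.pow_left b) a).1 (hpow x))
  have hsum : Nat.card H + #{y | y ^ a = 1 ∧ y ∉ H} + #{y | y ^ a ≠ 1 ∧ y ∉ H} = a * b := by
    rw [← hG, Nat.card_eq_fintype_card, Fintype.card_subtype, Nat.card_eq_fintype_card,
      ← card_univ, ← card_filter_add_card_filter_not (s := univ) (· ∈ H), add_assoc,
      ← card_filter_add_card_filter_not (s := univ.filter (· ∉ H)) (fun y : G ↦ y ^ a = 1)]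
    simp only [filter_filter, and_comm, ne_eq]
  have hB' : (Nat.card H).gcd b ∣ #{y | y ^ a ≠ 1 ∧ y ∉ H} := by
    refine (Nat.dvd_add_right (dvd_add (Nat.gcd_dvd_left (Nat.card H) b) hA)).1 ?_
    rw [hsum]
    exact (Nat.gcd_dvd_right _ _).mul_left _
  rw [hk]
  exact Nat.Coprime.mul_dvd_of_dvd_of_dvd
    ((hab.coprime_dvd_left (Nat.gcd_dvd_right _ _)).coprime_dvd_right (Nat.gcd_dvd_right _ _))
    hB hB'

open Finset in
theorem IsESPartition.eq_one_of_card_le {G : Type*} [Group G] [Finite G] {P : Finset (Subgroup G)}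
    (hP : IsESPartition ⊥ P) {H : Subgroup G} (hH : H ∈ P) {a b : ℕ} (hab : a.Coprime b)
    (hG : Nat.card G = a * b) (hle : Nat.card H ≤ a) : b = 1 := by
  classical
  have : Fintype G := Fintype.ofFinite G
  have hcard := hP.card_eq_one_add hH
  have hcop : a.Coprime P.card := by
    refine Nat.coprime_of_dvd fun p hp hpa hpP ↦ hp.one_lt.ne' (Nat.dvd_one.1 ?_)
    rw [← Nat.dvd_add_left (hpP.mul_right (Nat.card H - 1)), ← hcard, hG]
    exact hpa.mul_right b
  have he : ∀ K ∈ P, #{y | y ^ a ≠ 1 ∧ y ∈ K} = #{y : G | y ^ a ≠ 1} % Nat.card H := by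
    intro K hK
    obtain ⟨c, hc⟩ := hP.1.card_dvd_card_pow_ne_one hK hab hG
    have hlt : #{y | y ^ a ≠ 1 ∧ y ∈ K} < Nat.card K := by
      rw [Nat.card_eq_fintype_card, Fintype.card_subtype]
      refine card_lt_card (ssubset_iff_of_subset ?_ |>.2 ⟨1, by simp⟩)
      intro y
      simp
    rw [← card_filter_add_card_filter_not (s := univ.filter fun y : G ↦ y ^ a ≠ 1) (· ∈ K),
      filter_filter, filter_filter, hc, hP.2 H hH K hK, Nat.add_mul_mod_self_left,
      Nat.mod_eq_of_lt hlt]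
  have hE := hP.1.card_filter_eq_sum (fun y ↦ y ^ a ≠ 1) (by simp)
  rw [sum_congr rfl he, sum_const, smul_eq_mul] at hE
  have hdvd : a ∣ #{y : G | y ^ a ≠ 1} := by
    have h := dvd_card_pow_eq_one_of_coprime hab hG
    rw [Nat.card_eq_fintype_card, Fintype.card_subtype] at h
    rw [← Nat.dvd_add_right h, card_filter_add_card_filter_not, card_univ,
      ← Nat.card_eq_fintype_card, hG]
    exact dvd_mul_right a b
  have hzero : #{y : G | y ^ a ≠ 1} % Nat.card H = 0 :=
    Nat.eq_zero_of_dvd_of_lt (hcop.dvd_of_dvd_mul_left (hE ▸ hdvd))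
      ((Nat.mod_lt _ Nat.card_pos).trans_le hle)
  rw [hzero, mul_zero, card_eq_zero, filter_eq_empty_iff] at hE
  have hall : ∀ y : G, y ^ a = 1 := fun y ↦ not_not.1 (hE (mem_univ y))
  have := coprime_card_of_forall_pow_eq_one hab.symm hall
  exact Nat.Coprime.eq_one_of_dvd this (hG ▸ dvd_mul_left b a)

/-- A finite group partitioned by subgroups of equal order is a `p`-group. -/
theorem IsESPartition.exists_isPGroup {G : Type*} [Group G] [Finite G] {P : Finset (Subgroup G)}
    (hP : IsESPartition ⊥ P) : ∃ p : ℕ, p.Prime ∧ IsPGroup p G := by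
  obtain ⟨H, hH, -⟩ := hP.1.2.2.1 1
  have hcard := hP.card_eq_one_add hH
  have hlt : Nat.card H < Nat.card G :=
    lt_of_le_of_ne (H.card_le_card_group) fun h ↦ hP.1.2.1 H hH (H.eq_top_of_card_eq h)
  have hpos : 0 < Nat.card H := Nat.card_pos
  have h2 := hP.1.1
  have hsq : Nat.card H * Nat.card H ≤ Nat.card G := by
    obtain ⟨j, hj⟩ := Nat.exists_eq_add_of_le' hpos
    have hdvd : Nat.card H ∣ P.card - 1 := by
      refine (Nat.dvd_add_right H.card_subgroup_dvd_card).1 ?_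
      rw [hcard, add_right_comm, Nat.add_sub_cancel' (by lia), hj, Nat.add_sub_cancel]
      exact ⟨P.card, by ring⟩
    have hle := Nat.le_of_dvd (by lia) hdvd
    rw [hcard, hj, Nat.add_sub_cancel]
    rw [hj] at hle
    obtain ⟨i, hi⟩ := Nat.exists_eq_add_of_le hle
    have : P.card = j + 2 + i := by lia
    rw [this]
    nlinarith
  have hp : (Nat.card G).minFac.Prime := Nat.minFac_prime (by lia)
  refine ⟨_, hp, ?_⟩
  set p := (Nat.card G).minFac
  have hG := (Nat.ordProj_mul_ordCompl_eq_self (Nat.card G) p).symm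
  have hcop : (p ^ (Nat.card G).factorization p).Coprime
      (Nat.card G / p ^ (Nat.card G).factorization p) :=
    (Nat.coprime_ordCompl hp Nat.card_pos.ne').pow_left _
  generalize ha : p ^ (Nat.card G).factorization p = a at *
  generalize Nat.card G / a = b at *
  rcases le_or_gt (Nat.card H) a with h | h
  · rw [hP.eq_one_of_card_le hH hcop hG h, mul_one, ← ha] at hG
    exact IsPGroup.of_card hG
  · have hb : Nat.card H ≤ b := by nlinarith
    have := hP.eq_one_of_card_le hH hcop.symm (hG.trans (mul_comm a b)) hb
    rw [this, Nat.pow_eq_one] at ha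
    exact (ha.resolve_left hp.one_lt.ne' ▸
      hp.factorization_pos_of_dvd Nat.card_pos.ne' (Nat.minFac_dvd _)).false.elim

theorem IsStrictPartition.le_of_mem {G : Type*} [Group G] {S : Subgroup G}
    {P : Finset (Subgroup G)} (hP : IsStrictPartition S P) {H : Subgroup G} (hH : H ∈ P) :
    S ≤ H := by
  obtain ⟨K, hK, hKH⟩ := Finset.exists_mem_ne hP.1 H
  exact hP.2.2.2 H hH K hK hKH.symm ▸ inf_le_left

theorem IsESPartition.lt_of_mem {G : Type*} [Group G] [Finite G] {S : Subgroup G}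
    {P : Finset (Subgroup G)} (hP : IsESPartition S P) {H : Subgroup G} (hH : H ∈ P) :
    S < H := by
  refine lt_of_le_of_ne (hP.1.le_of_mem hH) fun h ↦ ?_
  obtain ⟨K, hK, hKH⟩ := Finset.exists_mem_ne hP.1.1 H
  refine hKH (Subgroup.eq_of_le_of_card_ge (h ▸ hP.1.le_of_mem hK) (hP.2 K hK H hH).le).symm

/-- Elements of `S` that are fused by an element outside `S` lie in the core of `S`. -/
theorem IsESPartition.conj_mem_normalCore {G : Type*} [Group G] [Finite G] {S : Subgroup G}
    {P : Finset (Subgroup G)} (hP : IsESPartition S P) {u x : G} (hu : u ∉ S) (hx : x ∈ S)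
    (hux : u * x * u⁻¹ ∈ S) : u * x * u⁻¹ ∈ S.normalCore := by
  have key : ∀ H ∈ P, ∀ u ∈ H, u ∉ S → ∀ x ∈ S, u * x * u⁻¹ ∈ S → ∀ v ∉ H,
      v * (u * x * u⁻¹) * v⁻¹ ∈ S := by
    intro H hH u huH hu x hx hux v hv
    obtain ⟨K, hK, hvK⟩ := hP.1.2.2.1 v
    obtain ⟨L, hL, hvuL⟩ := hP.1.2.2.1 (v * u)
    have hKH : K ≠ H := fun h ↦ hv (h ▸ hvK)
    have hLK : L ≠ K := fun h ↦ hu <| by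
      rw [← hP.1.2.2.2 K hK H hH hKH]
      exact ⟨(K.mul_mem_cancel_left hvK).1 (h ▸ hvuL), huH⟩
    rw [← hP.1.2.2.2 L hL K hK hLK]
    constructor
    · have := L.mul_mem (L.mul_mem hvuL (hP.1.le_of_mem hL hx)) (L.inv_mem hvuL)
      simpa [mul_assoc] using this
    · exact K.mul_mem (K.mul_mem hvK (hP.1.le_of_mem hK hux)) (K.inv_mem hvK)
  obtain ⟨H, hH, huH⟩ := hP.1.2.2.1 u
  obtain ⟨K, hK, hKH⟩ := Finset.exists_mem_ne hP.1.1 H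
  have hSK := hP.1.2.2.2 K hK H hH hKH
  have hconjK : ∀ v ∈ K, v * (u * x * u⁻¹) * v⁻¹ ∈ S := fun v hv ↦ by
    by_cases hvH : v ∈ H
    · have hvS : v ∈ S := hSK ▸ ⟨hv, hvH⟩
      exact S.mul_mem (S.mul_mem hvS hux) (S.inv_mem hvS)
    · exact key H hH u huH hu x hx hux v hvH
  obtain ⟨v, hvK, hvS⟩ := SetLike.exists_of_lt (hP.lt_of_mem hK)
  intro y
  by_cases hyK : y ∈ K
  · exact hconjK y hyK
  · have h1 : v * (v⁻¹ * (u * x * u⁻¹) * v) * v⁻¹ = u * x * u⁻¹ := by group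
    have h2 := hconjK v⁻¹ (K.inv_mem hvK)
    rw [inv_inv] at h2
    have := key K hK v hvK hvS _ h2 (h1.symm ▸ hux) y hyK
    rwa [h1] at this

/-- The transfer of a homomorphism `ϕ` from a malnormal subgroup extends `ϕ`. -/
theorem Subgroup.transfer_apply_of_malnormal {G A : Type*} [Group G] [CommGroup A] [Finite G]
    {S : Subgroup G} (hS : ∀ u ∉ S, ∀ x ∈ S, u * x * u⁻¹ ∈ S → x = 1) (ϕ : S →* A) (s : S) :
    MonoidHom.transfer ϕ (s : G) = ϕ s := by
  classical
  have : Fintype (Quotient (MulAction.orbitRel (zpowers (s : G)) (G ⧸ S))) := Fintype.ofFinite _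
  have hfix : ∀ z ∈ zpowers (s : G), z • (QuotientGroup.mk 1 : G ⧸ S) = QuotientGroup.mk 1 := by
    intro z hz
    rw [MulAction.Quotient.smul_mk, smul_eq_mul, mul_one, eq_comm, QuotientGroup.eq, inv_one,
      one_mul]
    exact (zpowers_le.2 s.2) hz
  rw [MonoidHom.transfer_eq_prod_quotient_orbitRel_zpowers_quot,
    Fintype.prod_eq_single ⟦(QuotientGroup.mk 1 : G ⧸ S)⟧]
  · set q : Quotient (MulAction.orbitRel (zpowers (s : G)) (G ⧸ S)) :=
      ⟦(QuotientGroup.mk 1 : G ⧸ S)⟧ with hq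
    have hq1 : q.out = QuotientGroup.mk 1 := by
      obtain ⟨z, hz⟩ := MulAction.orbitRel_apply.1 (Quotient.exact (q.out_eq.trans hq))
      exact hz.symm.trans (hfix z z.2)
    have hout : q.out.out ∈ S := by
      have := (QuotientGroup.eq (s := S)).1 (hq1.symm.trans (QuotientGroup.out_eq' q.out).symm)
      rwa [inv_one, one_mul] at this
    have hper : Function.minimalPeriod ((s : G) • ·) q.out = 1 := by
      rw [Function.minimalPeriod_eq_one_iff_isFixedPt, hq1]
      exact hfix s (mem_zpowers _)
    have hconj : ϕ (⟨q.out.out, hout⟩⁻¹ * s * ⟨q.out.out, hout⟩) = ϕ s := by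
      rw [map_mul, map_mul, map_inv, mul_right_comm, inv_mul_cancel, one_mul]
    rw [← hconj]
    congr 1
    ext
    simp [hper]
  · intro q hq
    have hout : q.out.out ∉ S := fun h ↦ hq <| by
      rw [← q.out_eq]
      congr 1
      rw [← QuotientGroup.out_eq' q.out, eq_comm, QuotientGroup.eq, inv_one, one_mul]
      exact h
    convert! map_one ϕ
    refine hS _ hout _ (QuotientGroup.out_conj_pow_minimalPeriod_mem S (s : G) q.out) ?_
    have := S.pow_mem s.2 (Function.minimalPeriod ((s : G) • ·) q.out)
    simpa [mul_assoc] using this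

theorem isESPartition_image {G G' : Type*} [Group G] [Group G'] {P : Finset (Subgroup G)}
    (f : Subgroup G → Subgroup G')
    [DecidableEq (Subgroup G')] (S' : Subgroup G') (htop : ∀ H ∈ P, f H ≠ ⊤)
    (hcov : ∀ g, ∃ H ∈ P, g ∈ f H) (hinf : ∀ H ∈ P, ∀ K ∈ P, H ≠ K → f H ⊓ f K = S')
    (hcard : ∀ H ∈ P, ∀ K ∈ P, Nat.card (f H) = Nat.card (f K)) :
    IsESPartition S' (P.image f) := by
  refine ⟨⟨?_, ?_, ?_, ?_⟩, ?_⟩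
  · by_contra! h
    obtain ⟨H, hH, -⟩ := hcov 1
    have hle := Finset.card_le_one.1 (Nat.lt_succ_iff.1 h)
    refine htop H hH ((Subgroup.eq_top_iff' _).2 fun g ↦ ?_)
    obtain ⟨K, hK, hg⟩ := hcov g
    exact hle _ (Finset.mem_image_of_mem f hK) _ (Finset.mem_image_of_mem f hH) ▸ hg
  · simpa using htop
  · simpa using hcov
  · simp only [Finset.forall_mem_image]
    exact fun H hH K hK hne ↦ hinf H hH K hK fun h ↦ hne (h ▸ rfl)
  · simpa only [Finset.forall_mem_image] using hcard

theorem IsESPartition.quotient {G : Type*} [Group G] [Finite G] {S : Subgroup G}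
    {P : Finset (Subgroup G)} (hP : IsESPartition S P) (N : Subgroup G) [N.Normal] (hN : N ≤ S)
    [DecidableEq (Subgroup (G ⧸ N))] :
    IsESPartition (S.map (QuotientGroup.mk' N)) (P.image (Subgroup.map (QuotientGroup.mk' N))) := by
  have hNH : ∀ H ∈ P, N ≤ H := fun H hH ↦ hN.trans (hP.1.le_of_mem hH)
  have hcomap : ∀ H, N ≤ H → (H.map (QuotientGroup.mk' N)).comap (QuotientGroup.mk' N) = H :=
    fun H hH ↦ Subgroup.comap_map_eq_self (by simpa using hH)
  have hmem : ∀ H, N ≤ H → ∀ g : G, (g : G ⧸ N) ∈ H.map (QuotientGroup.mk' N) ↔ g ∈ H :=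
    fun H hH g ↦ by
      conv_rhs => rw [← hcomap H hH]
      rfl
  refine isESPartition_image _ _ (fun H hH h ↦ hP.1.2.1 H hH ?_) (fun g ↦ ?_)
    (fun H hH K hK hHK ↦ ?_) ?_
  · rw [← hcomap H (hNH H hH), h, Subgroup.comap_top]
  · obtain ⟨g, rfl⟩ := QuotientGroup.mk_surjective g
    obtain ⟨H, hH, hg⟩ := hP.1.2.2.1 g
    exact ⟨H, hH, (hmem H (hNH H hH) g).2 hg⟩
  · ext g
    obtain ⟨g, rfl⟩ := QuotientGroup.mk_surjective g
    rw [Subgroup.mem_inf, hmem H (hNH H hH), hmem K (hNH K hK), hmem S hN,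
      ← hP.1.2.2.2 H hH K hK hHK, Subgroup.mem_inf]
  · have h : ∀ H ∈ P, Nat.card (H.map (QuotientGroup.mk' N)) * Nat.card N = Nat.card H := by
      intro H hH
      rw [← Subgroup.relIndex_ker, QuotientGroup.ker_mk',
        ← Nat.card_congr (Subgroup.subgroupOfEquivOfLe (hNH H hH)).toEquiv, mul_comm]
      exact (N.subgroupOf H).card_mul_index
    exact fun H hH K hK ↦ Nat.eq_of_mul_eq_mul_right (Nat.card_pos (α := N))
      ((h H hH).trans ((hP.2 H hH K hK).trans (h K hK).symm))

theorem IsESPartition.ker {G A : Type*} [Group G] [Group A] [Finite G] {S : Subgroup G}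
    {P : Finset (Subgroup G)} (hP : IsESPartition S P) (f : G →* A)
    (hf : S.map f = ⊤) [DecidableEq (Subgroup f.ker)] :
    IsESPartition (S.subgroupOf f.ker) (P.image fun H ↦ H.subgroupOf f.ker) := by
  have h : ∀ H, S ≤ H → Nat.card (H.subgroupOf f.ker) * Nat.card A = Nat.card H := by
    intro H hH
    have hHf : H.map f = ⊤ := top_le_iff.1 (hf ▸ Subgroup.map_mono hH)
    rw [← Subgroup.card_top (G := A), ← hHf, ← Subgroup.relIndex_ker, Subgroup.relIndex,
      ← (f.ker.subgroupOf H).card_mul_index, ← Subgroup.card_map_of_injective H.subtype_injective,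
      ← Subgroup.card_map_of_injective f.ker.subtype_injective, Subgroup.subgroupOf_map_subtype,
      Subgroup.subgroupOf_map_subtype, inf_comm]
  refine isESPartition_image _ _ (fun H hH htop ↦ hP.1.2.1 H hH ?_) (fun g ↦ ?_)
    (fun H hH K hK hHK ↦ ?_) ?_
  · refine H.eq_top_of_card_eq ?_
    rw [← h H (hP.1.le_of_mem hH), htop, ← Subgroup.top_subgroupOf f.ker, h ⊤ le_top,
      Subgroup.card_top]
  · obtain ⟨H, hH, hg⟩ := hP.1.2.2.1 g
    exact ⟨H, hH, hg⟩
  · rw [← hP.1.2.2.2 H hH K hK hHK]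
    rfl
  · have : Finite A := Finite.of_surjective f fun a ↦ by
      obtain ⟨s, -, hs⟩ := hf.ge (Subgroup.mem_top a)
      exact ⟨s, hs⟩
    exact fun H hH K hK ↦ Nat.eq_of_mul_eq_mul_right (Nat.card_pos (α := A))
      ((h H (hP.1.le_of_mem hH)).trans
        ((hP.2 H hH K hK).trans (h K (hP.1.le_of_mem hK)).symm))

theorem IsESPartition.isSolvable {G : Type*} [Group G] [Finite G] {S : Subgroup G}
    {P : Finset (Subgroup G)} (hP : IsESPartition S P) [hS : Group.IsSolvable S] :
    Group.IsSolvable G := by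
  classical
  rw [Group.isSolvable_def]
  induction hn : Nat.card G using Nat.strong_induction_on generalizing G with
  | _ n ih =>
  subst hn
  rw [← Group.isSolvable_def]
  by_cases hcore : S.normalCore = ⊥
  · by_cases hbot : S = ⊥
    · subst hbot
      obtain ⟨p, hp, hpG⟩ := hP.exists_isPGroup
      have := Fact.mk hp
      have := hpG.isNilpotent
      infer_instance
    · have hmal : ∀ u ∉ S, ∀ x ∈ S, u * x * u⁻¹ ∈ S → x = 1 := fun u hu x hx hux ↦ by
        have := hP.conj_mem_normalCore hu hx hux
        rwa [hcore, Subgroup.mem_bot, conj_eq_one_iff] at this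
      let V : G →* Abelianization S := MonoidHom.transfer Abelianization.of
      have hV : ∀ s : S, V s = Abelianization.of s :=
        Subgroup.transfer_apply_of_malnormal hmal Abelianization.of
      have hVS : S.map V = ⊤ := by
        refine (Subgroup.eq_top_iff' _).2 fun a ↦ ?_
        obtain ⟨s, rfl⟩ := QuotientGroup.mk_surjective a
        exact ⟨s, s.2, hV s⟩
      have hker : V.ker ≠ ⊤ := fun htop ↦ by
        have : Nontrivial S := S.nontrivial_iff_ne_bot.2 hbot
        refine (Group.IsSolvable.commutator_lt_top_of_nontrivial S).ne
          ((Subgroup.eq_top_iff' _).2 fun s ↦ ?_)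
        have hs : (s : G) ∈ V.ker := htop ▸ Subgroup.mem_top _
        rw [MonoidHom.mem_ker, hV] at hs
        rwa [← Abelianization.ker_of]
      have hlt : Nat.card V.ker < Nat.card G :=
        lt_of_le_of_ne V.ker.card_le_card_group fun h ↦ hker (V.ker.eq_top_of_card_eq h)
      have hsol : Group.IsSolvable (S.subgroupOf V.ker) :=
        Group.isSolvable_of_isSolvable_injective
          (f := (V.ker.subtype.comp (S.subgroupOf V.ker).subtype).codRestrict S fun x ↦ x.2)
          fun x y h ↦ Subtype.ext (Subtype.ext (congrArg ((↑) : S → G) h))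
      have : Group.IsSolvable V.ker := Group.isSolvable_def _ |>.2 <| ih _ hlt (hP.ker V hVS) rfl
      exact Group.isSolvable_of_ker_le_range V.ker.subtype V (by simp)
  · have hlt : Nat.card (G ⧸ S.normalCore) < Nat.card G := by
      rw [S.normalCore.card_eq_card_quotient_mul_card_subgroup]
      exact lt_mul_of_one_lt_right Nat.card_pos (S.normalCore.one_lt_card_iff_ne_bot.2 hcore)
    have hsol : Group.IsSolvable (S.map (QuotientGroup.mk' S.normalCore)) :=
      Group.isSolvable_of_surjective ((QuotientGroup.mk' S.normalCore).subgroupMap_surjective S)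
    have : Group.IsSolvable (G ⧸ S.normalCore) :=
      Group.isSolvable_def _ |>.2 <| ih _ hlt (hP.quotient S.normalCore S.normalCore_le) rfl
    have : Group.IsSolvable S.normalCore :=
      Group.isSolvable_of_isSolvable_injective (Subgroup.inclusion_injective S.normalCore_le)
    exact Group.isSolvable_of_ker_le_range S.normalCore.subtype
      (QuotientGroup.mk' S.normalCore) (by simp)

theorem solvable_of_ESPartition_solvable {G : Type*} [Group G] [Finite G]
    (S : Subgroup G) (P : Finset (Subgroup G)) (hP : IsESPartition S P)
    (hS : IsSolvable S) : IsSolvable G :=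
  hP.isSolvable (hS := hS)
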